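/- Counterfactual representation of the variance of the t-th component of the working-MSM efficient influence function: for every t ∈ {1, …, K+1}, σ²_t := E_p[(D*_t)²] = Σ_{d1∈𝒟} h(d1,t) · Σ_{l̄(t−1)} P^{d1}_{t−1}(l̄(t−1)) · Z(d1,t)(l̄(t−1)), where Z(d1,t)(l̄(t−1)) = Σ_{d2∈𝒟} h(d2,t) · 1{d1(l̄(t−1)) = d2(l̄(t−1))} · Σ_t(d1,d2)(d1(l̄(t−1)), l̄(t−1)) / g_{0:t−1}(d1(l̄(t−1)), l̄(t−1)) and Σ_t(d1,d2)(ā(t−1), l̄(t−1)) = Σ_{l_t} q_t(l_t | l̄(t−1), ā(t−1)) · (Q̄^{d1}_{t+1}(l̄(t)) − Q̄^{d1}_t(l̄(t−1))) · (Q̄^{d2}_{t+1}(l̄(t)) − Q̄^{d2}_t(l̄(t−1))). -/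

import Mathlib

/-!
Longitudinal data structure `O = (L(0), A(0), …, A(K), L(K+1))` with full-support pmf `p`.
Histories are encoded by full trajectories together with agreement predicates on time prefixes;
a sum over histories `l̄(t)` is encoded as a sum over full covariate trajectories whose
coordinates beyond `t` are pinned to an arbitrary base point `l₀` (`tailEq`).
-/

open Finset
open scoped Classical

noncomputable section

variable {K : ℕ} {L : Fin (K + 2) → Type} {A : Fin (K + 1) → Type}

/-- Covariate trajectories. -/
abbrev Traj (K : ℕ) (L : Fin (K + 2) → Type) : Type := ∀ s : Fin (K + 2), L s

/-- Treatment trajectories. -/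
abbrev Trt (K : ℕ) (A : Fin (K + 1) → Type) : Type := ∀ s : Fin (K + 1), A s

/-- Observations. -/
abbrev Obs (K : ℕ) (L : Fin (K + 2) → Type) (A : Fin (K + 1) → Type) : Type :=
  Traj K L × Trt K A

/-- Agreement of covariate trajectories on time indices `< t` (i.e. they share `l̄(t-1)`). -/
def aL (t : ℕ) (l l' : Traj K L) : Prop := ∀ s : Fin (K + 2), (s : ℕ) < t → l s = l' s

/-- Agreement of treatment trajectories on time indices `< t` (i.e. they share `ā(t-1)`). -/
def aA (t : ℕ) (a a' : Trt K A) : Prop := ∀ s : Fin (K + 1), (s : ℕ) < t → a s = a' s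

variable [∀ t, Fintype (L t)] [∀ t, Fintype (A t)]

/-- Mass of the event that the covariates agree with `l` on indices `< tL` and the treatments
agree with `a` on indices `< tA`. -/
def marg (p : Obs K L A → ℝ) (tL tA : ℕ) (l : Traj K L) (a : Trt K A) : ℝ :=
  ∑ o' : Obs K L A, if aL tL l o'.1 ∧ aA tA a o'.2 then p o' else 0

/-- The conditional factor `q_t(l_t ∣ l̄(t-1), ā(t-1))`. -/
def qC (p : Obs K L A → ℝ) (t : ℕ) (l : Traj K L) (a : Trt K A) : ℝ :=
  marg p (t + 1) t l a / marg p t t l a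

/-- The treatment mechanism factor `g_t(a_t ∣ l̄(t), ā(t-1))`. -/
def gC (p : Obs K L A → ℝ) (t : ℕ) (l : Traj K L) (a : Trt K A) : ℝ :=
  marg p (t + 1) (t + 1) l a / marg p (t + 1) t l a

/-- The cumulative treatment probability `g_{0:t-1}(ā(t-1), l̄(t-1))`; in particular
`gCum p 0 = 1` is the convention `g_{0:-1} = 1`. -/
def gCum (p : Obs K L A → ℝ) (t : ℕ) (l : Traj K L) (a : Trt K A) : ℝ :=
  ∏ m ∈ Finset.range t, gC p m l a

/-- The treatment trajectory determined by the regimen `d` along the covariates `l`. -/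
def aOf (d : ∀ t : Fin (K + 1), Traj K L → A t) (l : Traj K L) : Trt K A := fun s => d s l

/-- A regimen is adapted: `d_t` depends only on `l̄(t)`. -/
def Adapted (d : ∀ t : Fin (K + 1), Traj K L → A t) : Prop :=
  ∀ t : Fin (K + 1), ∀ l l' : Traj K L, aL ((t : ℕ) + 1) l l' → d t l = d t l'

/-- The event `ā(t-1) = d(l̄(t-1))`. -/
def follows (d : ∀ t : Fin (K + 1), Traj K L → A t) (t : ℕ) (o : Obs K L A) : Prop :=
  ∀ s : Fin (K + 1), (s : ℕ) < t → o.2 s = d s o.1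

/-- The inverse probability weight
`H^d_t(ā(t-1), l̄(t-1)) = 1{ā(t-1) = d(l̄(t-1))} / g_{0:t-1}`; `Hd p d 0 = 1`. -/
def Hd (p : Obs K L A → ℝ) (d : ∀ t : Fin (K + 1), Traj K L → A t) (t : ℕ)
    (o : Obs K L A) : ℝ :=
  (if follows d t o then (1 : ℝ) else 0) / gCum p t o.1 o.2

/-- The sequential regression `Q̄^d_t(l̄(t-1))`, defined downward from
`Q̄^d_{K+2}(l̄(K+1)) = y(l_{K+1})` by
`Q̄^d_t(l̄(t-1)) = Σ_{l_t} q_t(l_t ∣ l̄(t-1), d(l̄(t-1))) Q̄^d_{t+1}(l̄(t))`. -/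
def Qbar (p : Obs K L A → ℝ) (y : L (Fin.last (K + 1)) → ℝ)
    (d : ∀ t : Fin (K + 1), Traj K L → A t) (t : ℕ) (l : Traj K L) : ℝ :=
  if ht : t < K + 2 then
    ∑ v : L ⟨t, ht⟩,
      qC p t (Function.update l ⟨t, ht⟩ v) (aOf d (Function.update l ⟨t, ht⟩ v)) *
        Qbar p y d (t + 1) (Function.update l ⟨t, ht⟩ v)
  else y (l (Fin.last (K + 1)))
termination_by K + 2 - t
decreasing_by omega

/-- The G-computation mass `P^d_t(l̄(t)) = Π_{m=0}^{t} q_m(l_m ∣ l̄(m-1), d(l̄(m-1)))`. -/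
def Pd (p : Obs K L A → ℝ) (d : ∀ t : Fin (K + 1), Traj K L → A t) (t : ℕ)
    (l : Traj K L) : ℝ :=
  ∏ m ∈ Finset.range (t + 1), qC p m l (aOf d l)

/-- `l` agrees with the base point `l₀` on indices `> t`: summing a function of `l̄(t)` over
trajectories pinned to `l₀` beyond `t` realizes the sum over histories `l̄(t)`. -/
def tailEq (t : ℕ) (l₀ l : Traj K L) : Prop := ∀ s : Fin (K + 2), t < (s : ℕ) → l s = l₀ s

/-- The `t`-th component of the efficient influence function,
`D^{*,d}_t = H^d_t · (Q̄^d_{t+1} - Q̄^d_t)` (with `H^d_0 = 1`, so the `t = 0` component is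
`Q̄^d_1(l_0) - Q̄^d_0`). -/
def Dst (p : Obs K L A → ℝ) (y : L (Fin.last (K + 1)) → ℝ)
    (d : ∀ t : Fin (K + 1), Traj K L → A t) (t : ℕ) (o : Obs K L A) : ℝ :=
  Hd p d t o * (Qbar p y d (t + 1) o.1 - Qbar p y d t o.1)

/-- The conditional covariance
`Σ_t(d1,d2)(ā(t-1), l̄(t-1)) = Σ_{l_t} q_t(l_t ∣ l̄(t-1), ā(t-1)) (Q̄^{d1}_{t+1} - Q̄^{d1}_t)(Q̄^{d2}_{t+1} - Q̄^{d2}_t)`. -/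
def Scov (p : Obs K L A → ℝ) (y : L (Fin.last (K + 1)) → ℝ)
    (d1 d2 : ∀ t : Fin (K + 1), Traj K L → A t) (t : ℕ) (ht : t < K + 2)
    (l : Traj K L) (a : Trt K A) : ℝ :=
  ∑ v : L ⟨t, ht⟩,
    qC p t (Function.update l ⟨t, ht⟩ v) a *
      ((Qbar p y d1 (t + 1) (Function.update l ⟨t, ht⟩ v) - Qbar p y d1 t l) *
        (Qbar p y d2 (t + 1) (Function.update l ⟨t, ht⟩ v) - Qbar p y d2 t l))

/-- The `t`-th component of the working-MSM efficient influence function,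
`D*_t = Σ_{d ∈ 𝒟} h(d,t) H^d_t (Q̄^d_{t+1} - Q̄^d_t)` (with `H^d_0 = 1`). -/
def DstM {D : Type} [Fintype D] (p : Obs K L A → ℝ) (y : L (Fin.last (K + 1)) → ℝ)
    (ds : D → ∀ t : Fin (K + 1), Traj K L → A t) (h : D → ℕ → ℝ) (t : ℕ)
    (o : Obs K L A) : ℝ :=
  ∑ i : D, h i t *
    (Hd p (ds i) t o * (Qbar p y (ds i) (t + 1) o.1 - Qbar p y (ds i) t o.1))

section Congruence

set_option linter.unusedSectionVars false

theorem aL.mono {t u : ℕ} {l l' : Traj K L} (h : aL t l l') (hu : u ≤ t) : aL u l l' :=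
  fun s hs => h s (hs.trans_le hu)

theorem aA.mono {t u : ℕ} {a a' : Trt K A} (h : aA t a a') (hu : u ≤ t) : aA u a a' :=
  fun s hs => h s (hs.trans_le hu)

theorem aL_update {t : ℕ} (ht : t < K + 2) (l : Traj K L) (v : L ⟨t, ht⟩) :
    aL t (Function.update l ⟨t, ht⟩ v) l := fun s hs =>
  Function.update_of_ne (by rintro rfl; exact lt_irrefl _ hs) _ _

theorem aL.update {t : ℕ} {l l' : Traj K L} (h : aL t l l') (ht : t < K + 2) (v : L ⟨t, ht⟩) :
    aL (t + 1) (Function.update l ⟨t, ht⟩ v) (Function.update l' ⟨t, ht⟩ v) := by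
  intro s hs
  by_cases hst : s = ⟨t, ht⟩
  · subst hst; simp
  · rw [Function.update_of_ne hst, Function.update_of_ne hst]
    exact h s (by have : (s : ℕ) ≠ t := fun e => hst (Fin.ext e)
                  omega)

theorem Adapted.aA_aOf {d : ∀ t : Fin (K + 1), Traj K L → A t} (hd : Adapted d) {t : ℕ}
    {l l' : Traj K L} (h : aL t l l') : aA t (aOf d l) (aOf d l') :=
  fun s hs => hd s l l' (h.mono hs)

theorem marg_congr (p : Obs K L A → ℝ) {tL tA : ℕ} {l l' : Traj K L} {a a' : Trt K A}
    (hl : aL tL l l') (ha : aA tA a a') : marg p tL tA l a = marg p tL tA l' a' := by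
  refine Finset.sum_congr rfl fun o _ => if_congr (and_congr ?_ ?_) rfl rfl
  · exact forall₂_congr fun s hs => by rw [hl s hs]
  · exact forall₂_congr fun s hs => by rw [ha s hs]

theorem qC_congr (p : Obs K L A → ℝ) {t : ℕ} {l l' : Traj K L} {a a' : Trt K A}
    (hl : aL (t + 1) l l') (ha : aA t a a') : qC p t l a = qC p t l' a' := by
  rw [qC, qC, marg_congr p hl ha, marg_congr p (hl.mono t.le_succ) ha]

theorem gC_congr (p : Obs K L A → ℝ) {t : ℕ} {l l' : Traj K L} {a a' : Trt K A}
    (hl : aL (t + 1) l l') (ha : aA (t + 1) a a') : gC p t l a = gC p t l' a' := by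
  rw [gC, gC, marg_congr p hl ha, marg_congr p hl (ha.mono t.le_succ)]

theorem gCum_congr (p : Obs K L A → ℝ) {t : ℕ} {l l' : Traj K L} {a a' : Trt K A}
    (hl : aL t l l') (ha : aA t a a') : gCum p t l a = gCum p t l' a' :=
  Finset.prod_congr rfl fun _ hm =>
    have hm := Finset.mem_range.1 hm
    gC_congr p (hl.mono hm) (ha.mono hm)

theorem Qbar_congr (p : Obs K L A → ℝ) (y : L (Fin.last (K + 1)) → ℝ)
    {d : ∀ t : Fin (K + 1), Traj K L → A t} (hd : Adapted d) (t : ℕ) {l l' : Traj K L}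
    (hl : aL t l l') : Qbar p y d t l = Qbar p y d t l' := by
  rw [Qbar, Qbar]
  split_ifs with ht
  · refine Finset.sum_congr rfl fun v _ => ?_
    have hv := hl.update ht v
    rw [qC_congr p hv (hd.aA_aOf (hv.mono t.le_succ)), Qbar_congr p y hd (t + 1) hv]
  · rw [hl (Fin.last (K + 1)) (by simp only [Fin.val_last]; omega)]
termination_by K + 2 - t

end Congruence

section Factorization

theorem marg_pos {p : Obs K L A → ℝ} (hp : ∀ o, 0 < p o) (tL tA : ℕ) (l : Traj K L)
    (a : Trt K A) : 0 < marg p tL tA l a := by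
  refine Finset.sum_pos' (fun o _ => ?_) ⟨(l, a), Finset.mem_univ _, ?_⟩
  · split_ifs
    exacts [(hp o).le, le_rfl]
  · rw [if_pos ⟨fun _ _ => rfl, fun _ _ => rfl⟩]
    exact hp _

theorem gCum_pos {p : Obs K L A → ℝ} (hp : ∀ o, 0 < p o) (t : ℕ) (l : Traj K L)
    (a : Trt K A) : 0 < gCum p t l a :=
  Finset.prod_pos fun _ _ => div_pos (marg_pos hp _ _ _ _) (marg_pos hp _ _ _ _)

theorem marg_succ_left {p : Obs K L A → ℝ} (hp : ∀ o, 0 < p o) (t : ℕ) (l : Traj K L)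
    (a : Trt K A) : marg p (t + 1) t l a = qC p t l a * marg p t t l a :=
  (div_mul_cancel₀ _ (marg_pos hp t t l a).ne').symm

/-- The mass of a joint history factors into covariate and treatment conditionals. -/
theorem marg_self_eq_prod {p : Obs K L A → ℝ} (hp : ∀ o, 0 < p o)
    (hp1 : ∑ o : Obs K L A, p o = 1) (t : ℕ) (l : Traj K L) (a : Trt K A) :
    marg p t t l a = (∏ m ∈ Finset.range t, qC p m l a) * gCum p t l a := by
  induction t with
  | zero => simpa [marg, gCum, aL, aA] using hp1
  | succ t ih =>
    have hg : marg p (t + 1) (t + 1) l a = gC p t l a * marg p (t + 1) t l a :=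
      (div_mul_cancel₀ _ (marg_pos hp (t + 1) t l a).ne').symm
    rw [hg, marg_succ_left hp, ih, gCum, gCum, Finset.prod_range_succ, Finset.prod_range_succ]
    ring

end Factorization

section HistorySums

/-- Summing a function of `l̄(t)` over the observations that follow `d` before time `t`. -/
theorem sum_follows_eq (p : Obs K L A → ℝ) {d : ∀ t : Fin (K + 1), Traj K L → A t}
    (hd : Adapted d) (t : ℕ) (l₀ : Traj K L) (G : Traj K L → ℝ)
    (hG : ∀ l l', aL (t + 1) l l' → G l = G l') :
    ∑ o : Obs K L A, (if follows d t o then p o * G o.1 else 0) =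
      ∑ l : Traj K L, if tailEq t l₀ l then marg p (t + 1) t l (aOf d l) * G l else 0 := by
  have hr : ∀ l : Traj K L,
      (if tailEq t l₀ l then marg p (t + 1) t l (aOf d l) * G l else 0) =
        ∑ o : Obs K L A, if l = (fun s : Fin (K + 2) => if (s : ℕ) < t + 1 then o.1 s else l₀ s) then
          (if follows d t o then p o * G o.1 else 0) else 0 := by
    intro l
    have hiff : ∀ o : Obs K L A, l = (fun s : Fin (K + 2) => if (s : ℕ) < t + 1 then o.1 s else l₀ s) ↔
        tailEq t l₀ l ∧ aL (t + 1) l o.1 := by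
      intro o
      constructor
      · rintro rfl
        exact ⟨fun s hs => if_neg (by omega), fun s hs => if_pos hs⟩
      · rintro ⟨h1, h2⟩
        funext s
        split_ifs with hs
        exacts [h2 s hs, h1 s (by omega)]
    simp only [hiff]
    by_cases hl : tailEq t l₀ l
    · simp only [hl, true_and, if_true, marg, Finset.sum_mul]
      refine Finset.sum_congr rfl fun o _ => ?_
      by_cases ho : aL (t + 1) l o.1
      · have hf : aA t (aOf d l) o.2 ↔ follows d t o :=
          forall₂_congr fun s hs => by
            rw [hd.aA_aOf (ho.mono t.le_succ) s hs, eq_comm, aOf]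
        simp only [ho, true_and, if_true, hf, hG l o.1 ho, ite_mul, zero_mul]
      · simp [ho]
    · simp [hl]
  simp only [hr]
  rw [Finset.sum_comm]
  simp

/-- A sum over `l̄(t)` is an iterated sum over `l̄(t-1)` and `l_t`. -/
theorem sum_tailEq_succ {t : ℕ} (ht1 : 1 ≤ t) (ht : t < K + 2) (l₀ : Traj K L)
    (f : Traj K L → ℝ) :
    (∑ l : Traj K L, if tailEq t l₀ l then f l else 0) =
      ∑ l : Traj K L, if tailEq (t - 1) l₀ l then
        ∑ v : L ⟨t, ht⟩, f (Function.update l ⟨t, ht⟩ v) else 0 := by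
  rw [← Finset.sum_filter, ← Finset.sum_filter, ← Finset.sum_product']
  refine Finset.sum_nbij' (fun l => (Function.update l ⟨t, ht⟩ (l₀ ⟨t, ht⟩), l ⟨t, ht⟩))
    (fun x => Function.update x.1 ⟨t, ht⟩ x.2) ?_ ?_ ?_ ?_ ?_
  · intro l hl
    simp only [Finset.mem_filter, Finset.mem_univ, true_and, Finset.mem_product, and_true] at hl ⊢
    intro s hs
    by_cases hst : s = ⟨t, ht⟩
    · subst hst; simp
    · rw [Function.update_of_ne hst]
      exact hl s (by have : (s : ℕ) ≠ t := fun e => hst (Fin.ext e)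
                     omega)
  · rintro ⟨l, v⟩ hl
    simp only [Finset.mem_filter, Finset.mem_univ, true_and, Finset.mem_product, and_true] at hl ⊢
    intro s hs
    rw [Function.update_of_ne (by rintro rfl; exact lt_irrefl _ hs)]
    exact hl s (by omega)
  · intro l _
    simp
  · rintro ⟨l, v⟩ hl
    simp only [Finset.mem_filter, Finset.mem_univ, true_and, Finset.mem_product, and_true] at hl
    have hl' : l₀ ⟨t, ht⟩ = l ⟨t, ht⟩ := (hl ⟨t, ht⟩ (by simp only; omega)).symm
    simp [hl']
  · intro l _
    simp

end HistorySums

/-- Counterfactual representation of the covariance of the `t`-th influence function components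
of two regimens. -/
theorem sum_Dst_mul_Dst {p : Obs K L A → ℝ} (hp : ∀ o, 0 < p o)
    (hp1 : ∑ o : Obs K L A, p o = 1) (y : L (Fin.last (K + 1)) → ℝ)
    {d e : ∀ t : Fin (K + 1), Traj K L → A t} (hd : Adapted d) (he : Adapted e)
    {t : ℕ} (ht1 : 1 ≤ t) (ht : t < K + 2) (l₀ : Traj K L) :
    ∑ o : Obs K L A, p o * (Dst p y d t o * Dst p y e t o) =
      ∑ l : Traj K L, if tailEq (t - 1) l₀ l then
        Pd p d (t - 1) l *
          ((if ∀ s : Fin (K + 1), (s : ℕ) < t → d s l = e s l then (1 : ℝ) else 0) *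
            Scov p y d e t ht l (aOf d l) / gCum p t l (aOf d l)) else 0 := by
  have hagree : ∀ {l l' : Traj K L}, aL t l l' →
      ((∀ s : Fin (K + 1), (s : ℕ) < t → d s l = e s l) ↔
        ∀ s : Fin (K + 1), (s : ℕ) < t → d s l' = e s l') := fun hl =>
    forall₂_congr fun s hs => by rw [hd s _ _ (hl.mono hs), he s _ _ (hl.mono hs)]
  set G : Traj K L → ℝ := fun l =>
    (if ∀ s : Fin (K + 1), (s : ℕ) < t → d s l = e s l then (1 : ℝ) else 0) /
      gCum p t l (aOf d l) ^ 2 *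
      ((Qbar p y d (t + 1) l - Qbar p y d t l) * (Qbar p y e (t + 1) l - Qbar p y e t l))
    with hGdef
  have hG : ∀ l l', aL (t + 1) l l' → G l = G l' := by
    intro l l' hl
    have hl' := hl.mono t.le_succ
    simp only [hGdef, hagree hl', gCum_congr p hl' (hd.aA_aOf hl'), Qbar_congr p y hd _ hl,
      Qbar_congr p y he _ hl, Qbar_congr p y hd _ hl', Qbar_congr p y he _ hl']
  have hleft : ∀ o : Obs K L A, p o * (Dst p y d t o * Dst p y e t o) =
      if follows d t o then p o * G o.1 else 0 := by
    intro o
    by_cases hf : follows d t o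
    · have hfe : follows e t o ↔ ∀ s : Fin (K + 1), (s : ℕ) < t → d s o.1 = e s o.1 :=
        forall₂_congr fun s hs => by rw [hf s hs]
      have hg : gCum p t o.1 o.2 = gCum p t o.1 (aOf d o.1) :=
        gCum_congr p (fun _ _ => rfl) hf
      simp only [Dst, Hd, hf, hfe, hg, if_true, hGdef]
      ring
    · simp [Dst, Hd, hf]
  rw [Finset.sum_congr rfl fun o _ => hleft o, sum_follows_eq p hd t l₀ G hG,
    sum_tailEq_succ ht1 ht]
  refine Finset.sum_congr rfl fun l _ => ?_
  refine if_congr Iff.rfl ?_ rfl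
  have hPd : marg p t t l (aOf d l) = Pd p d (t - 1) l * gCum p t l (aOf d l) := by
    rw [marg_self_eq_prod hp hp1, Pd, Nat.sub_add_cancel ht1]
  have hg := (gCum_pos hp t l (aOf d l)).ne'
  rw [Scov, Finset.mul_sum, Finset.sum_div, Finset.mul_sum]
  refine Finset.sum_congr rfl fun v _ => ?_
  have hv := aL_update ht l v
  have ha := hd.aA_aOf hv
  rw [marg_congr p (fun _ _ => rfl) ha, marg_succ_left hp, marg_congr p hv fun _ _ => rfl, hPd]
  simp only [hGdef, hagree hv, gCum_congr p hv ha, Qbar_congr p y hd _ hv, Qbar_congr p y he _ hv]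
  field_simp

/-- counterfactual representation of the variance of the `t`-th component of the
working-MSM efficient influence function,
`σ²_t = Σ_{d1} h(d1,t) Σ_{l̄(t-1)} P^{d1}_{t-1}(l̄(t-1)) Z(d1,t)(l̄(t-1))`. -/
theorem msm_component_variance_counterfactual [∀ t, Nonempty (L t)] [∀ t, Nonempty (A t)]
    {D : Type} [Fintype D] [Nonempty D]
    (p : Obs K L A → ℝ) (hp : ∀ o, 0 < p o) (hp1 : ∑ o : Obs K L A, p o = 1)
    (y : L (Fin.last (K + 1)) → ℝ)
    (ds : D → ∀ t : Fin (K + 1), Traj K L → A t) (hds : ∀ i, Adapted (ds i))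
    (h : D → ℕ → ℝ)
    (t : ℕ) (ht1 : 1 ≤ t) (ht2 : t ≤ K + 1)
    (l₀ : Traj K L) :
    ∑ o : Obs K L A, p o * DstM p y ds h t o ^ 2
      = ∑ i : D, h i t *
          ∑ l : Traj K L,
            if tailEq (t - 1) l₀ l then
              Pd p (ds i) (t - 1) l *
                ((∑ j : D, h j t *
                    (if (∀ s : Fin (K + 1), (s : ℕ) < t → ds i s l = ds j s l)
                      then (1 : ℝ) else 0) *
                    Scov p y (ds i) (ds j) t (by omega) l (aOf (ds i) l)) /
                  gCum p t l (aOf (ds i) l))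
            else 0 := by
  have hsq : ∀ o : Obs K L A, p o * DstM p y ds h t o ^ 2 =
      ∑ i, ∑ j, h i t * h j t * (p o * (Dst p y (ds i) t o * Dst p y (ds j) t o)) := by
    intro o
    rw [sq, DstM, Finset.sum_mul_sum, Finset.mul_sum]
    refine Finset.sum_congr rfl fun i _ => ?_
    rw [Finset.mul_sum]
    refine Finset.sum_congr rfl fun j _ => ?_
    rw [Dst, Dst]
    ring
  rw [Finset.sum_congr rfl fun o _ => hsq o, Finset.sum_comm]
  refine Finset.sum_congr rfl fun i _ => ?_
  rw [Finset.sum_comm]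
  simp only [← Finset.mul_sum,
    sum_Dst_mul_Dst hp hp1 y (hds i) (hds _) ht1 (Nat.lt_succ_of_le ht2) l₀, mul_assoc]
  congr 1
  simp only [Finset.mul_sum]
  rw [Finset.sum_comm]
  refine Finset.sum_congr rfl fun l _ => ?_
  split_ifs with hl
  · rw [Finset.sum_div, Finset.mul_sum]
    refine Finset.sum_congr rfl fun j _ => ?_
    ring
  · simp

end
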